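/- Lemma (extension of the reflection inequality to Borel sets). Let μ be a finite Borel measure on ℝ² and let R₂ = {(y,d) ∈ ℝ² : y > 0, d > −y/2}. If μ(R) ≤ μ(R') for every set R of the form R₂ ∩ (I₁ × I₂) with I₁, I₂ intervals in ℝ, then μ(B) ≤ μ(B') for every Borel set B ⊂ R₂. -/

import Mathlib

open MeasureTheory Set

/-- The reflection `A' = {(x, −x−y) : (x,y) ∈ A}`. -/
def reflP (A : Set (ℝ × ℝ)) : Set (ℝ × ℝ) := (fun p : ℝ × ℝ => (p.1, -p.1 - p.2)) '' A

/-- `R₂ = {(y,d) : y > 0, d > −y/2}`. -/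
def R2set : Set (ℝ × ℝ) := {p : ℝ × ℝ | 0 < p.1 ∧ -(1/2) * p.1 < p.2}

/-- The index of the dyadic square of side `2⁻ⁿ` containing a point of the plane. -/
noncomputable def dyadicIndex (n : ℕ) (p : ℝ × ℝ) : ℤ × ℤ := (⌊2 ^ n * p.1⌋, ⌊2 ^ n * p.2⌋)

lemma measurable_dyadicIndex (n : ℕ) : Measurable (dyadicIndex n) := by
  unfold dyadicIndex
  fun_prop

lemma floor_two_pow_mul_eq_of_succ {n : ℕ} {x y : ℝ}
    (h : ⌊(2 : ℝ) ^ (n + 1) * x⌋ = ⌊(2 : ℝ) ^ (n + 1) * y⌋) :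
    ⌊(2 : ℝ) ^ n * x⌋ = ⌊(2 : ℝ) ^ n * y⌋ := by
  have key (z : ℝ) : ⌊(2 : ℝ) ^ n * z⌋ = ⌊(2 : ℝ) ^ (n + 1) * z⌋ / 2 := by
    have := Int.floor_div_natCast ((2 : ℝ) ^ (n + 1) * z) 2
    rw [← Nat.cast_ofNat (R := ℤ), ← this]
    congr 1
    push_cast
    ring
  rw [key, key, h]

lemma dyadicIndex_eq_of_succ {n : ℕ} {p q : ℝ × ℝ}
    (h : dyadicIndex (n + 1) p = dyadicIndex (n + 1) q) : dyadicIndex n p = dyadicIndex n q := by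
  simp only [dyadicIndex, Prod.mk.injEq] at h ⊢
  exact ⟨floor_two_pow_mul_eq_of_succ h.1, floor_two_pow_mul_eq_of_succ h.2⟩

lemma abs_sub_lt_of_floor_two_pow_mul_eq {n : ℕ} {x y : ℝ}
    (h : ⌊(2 : ℝ) ^ n * x⌋ = ⌊(2 : ℝ) ^ n * y⌋) : |x - y| < (1 / 2) ^ n := by
  have := Int.abs_sub_lt_one_of_floor_eq_floor h
  rw [← mul_sub, abs_mul, abs_of_pos (by positivity)] at this
  rw [one_div, inv_pow, ← one_div, lt_div_iff₀ (by positivity)]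
  linarith

lemma dist_lt_of_dyadicIndex_eq {n : ℕ} {p q : ℝ × ℝ}
    (h : dyadicIndex n p = dyadicIndex n q) : dist p q < (1 / 2) ^ n := by
  simp only [dyadicIndex, Prod.mk.injEq] at h
  rw [Prod.dist_eq, max_lt_iff, Real.dist_eq, Real.dist_eq]
  exact ⟨abs_sub_lt_of_floor_two_pow_mul_eq h.1, abs_sub_lt_of_floor_two_pow_mul_eq h.2⟩

lemma dyadicIndex_preimage_singleton (n : ℕ) (k : ℤ × ℤ) :
    ∃ I J : Set ℝ, I.OrdConnected ∧ J.OrdConnected ∧ dyadicIndex n ⁻¹' {k} = I ×ˢ J := by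
  have hmono : Monotone fun x : ℝ => ⌊(2 : ℝ) ^ n * x⌋ := fun x y hxy =>
    Int.floor_mono (by gcongr)
  refine ⟨_, _, (ordConnected_singleton (a := k.1)).preimage_mono hmono,
    (ordConnected_singleton (a := k.2)).preimage_mono hmono, ?_⟩
  ext p
  simp [dyadicIndex, Prod.ext_iff]

/-- The union of the dyadic squares of side `2⁻ⁿ` contained in `U`. -/
def dyadicInner (U : Set (ℝ × ℝ)) (n : ℕ) : Set (ℝ × ℝ) :=
  dyadicIndex n ⁻¹' {k | dyadicIndex n ⁻¹' {k} ⊆ U}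

lemma monotone_dyadicInner (U : Set (ℝ × ℝ)) : Monotone (dyadicInner U) :=
  monotone_nat_of_le_succ fun _ _ hp _ hq => hp (dyadicIndex_eq_of_succ hq)

lemma iUnion_dyadicInner {U : Set (ℝ × ℝ)} (hU : IsOpen U) : ⋃ n, dyadicInner U n = U := by
  refine Subset.antisymm (iUnion_subset fun n p hp => hp rfl) fun p hp => ?_
  obtain ⟨ε, hε, hball⟩ := Metric.isOpen_iff.1 hU p hp
  obtain ⟨n, hn⟩ := exists_pow_lt_of_lt_one hε (by norm_num : (1 / 2 : ℝ) < 1)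
  exact mem_iUnion.2 ⟨n, fun q hq => hball ((dist_lt_of_dyadicIndex_eq hq).trans hn)⟩

/-- A measure on the plane that is dominated on products of intervals by a finite measure is
dominated by it. -/
lemma measure_le_of_le_on_rectangles {μ ν : Measure (ℝ × ℝ)} [IsFiniteMeasure ν]
    (h : ∀ I J : Set ℝ, I.OrdConnected → J.OrdConnected → μ (I ×ˢ J) ≤ ν (I ×ˢ J)) : μ ≤ ν := by
  have hinner (U : Set (ℝ × ℝ)) (n : ℕ) : μ (dyadicInner U n) ≤ ν (dyadicInner U n) := by
    have hmeas (k : ℤ × ℤ) : MeasurableSet (dyadicIndex n ⁻¹' {k}) :=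
      measurable_dyadicIndex n (measurableSet_singleton k)
    rw [dyadicInner, ← tsum_measure_preimage_singleton (to_countable _) fun k _ => hmeas k,
      ← tsum_measure_preimage_singleton (to_countable _) fun k _ => hmeas k]
    refine ENNReal.tsum_le_tsum fun k => ?_
    obtain ⟨I, J, hI, hJ, hIJ⟩ := dyadicIndex_preimage_singleton n k
    rw [hIJ]
    exact h I J hI hJ
  have hopen (U : Set (ℝ × ℝ)) (hU : IsOpen U) : μ U ≤ ν U := by
    rw [← iUnion_dyadicInner hU, (monotone_dyadicInner U).measure_iUnion,
      (monotone_dyadicInner U).measure_iUnion]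
    exact iSup_mono (hinner U)
  refine Measure.le_intro fun s _ _ => ?_
  rw [s.measure_eq_iInf_isOpen ν]
  exact le_iInf₂ fun U hsU => le_iInf fun hU => (measure_mono hsU).trans (hopen U hU)

lemma reflP_eq_preimage (A : Set (ℝ × ℝ)) :
    reflP A = (fun p : ℝ × ℝ => (p.1, -p.1 - p.2)) ⁻¹' A := by
  have hinv : Function.Involutive fun p : ℝ × ℝ => (p.1, -p.1 - p.2) := fun p => by simp
  exact congrFun hinv.image_eq_preimage_symm A

lemma measurableSet_R2set : MeasurableSet R2set :=
  (measurableSet_lt measurable_const measurable_fst).inter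
    (measurableSet_lt (measurable_fst.const_mul _) measurable_snd)

/-- **Lemma.** If a finite Borel measure on `ℝ²` satisfies `μ(R) ≤ μ(R')` for every set of the
form `R = R₂ ∩ (I₁ × I₂)` with `I₁, I₂` intervals, then `μ(B) ≤ μ(B')` for every Borel set
`B ⊆ R₂`. -/
theorem rect_reflection_ineq_extends_to_borel (μ : Measure (ℝ × ℝ)) [IsFiniteMeasure μ]
    (hrect : ∀ I₁ I₂ : Set ℝ, I₁.OrdConnected → I₂.OrdConnected →
      μ (R2set ∩ I₁ ×ˢ I₂) ≤ μ (reflP (R2set ∩ I₁ ×ˢ I₂))) :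
    ∀ B : Set (ℝ × ℝ), MeasurableSet B → B ⊆ R2set → μ B ≤ μ (reflP B) := by
  intro B hB hBR
  have hT : Measurable fun p : ℝ × ℝ => (p.1, -p.1 - p.2) := by fun_prop
  have hmap {A : Set (ℝ × ℝ)} (hA : MeasurableSet A) :
      μ.map (fun p : ℝ × ℝ => (p.1, -p.1 - p.2)) A = μ (reflP A) := by
    rw [Measure.map_apply hT hA, reflP_eq_preimage]
  have hle : μ.restrict R2set ≤
      (μ.map fun p : ℝ × ℝ => (p.1, -p.1 - p.2)).restrict R2set := by
    refine measure_le_of_le_on_rectangles fun I J hI hJ => ?_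
    have hIJ : MeasurableSet (I ×ˢ J) := hI.measurableSet.prod hJ.measurableSet
    rw [Measure.restrict_apply hIJ, Measure.restrict_apply hIJ, inter_comm,
      hmap (measurableSet_R2set.inter hIJ)]
    exact hrect I J hI hJ
  simpa [Measure.restrict_apply hB, inter_eq_left.2 hBR, hmap hB] using hle B
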